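/- If B_t and B_c are n×m real matrices such that tr((B_t B_tᵀ)(B_c B_cᵀ)) = 0, then B_c B_cᵀ B_t = O (the n×m zero matrix); consequently the Word2DM target-context gradient term (1 − σ(0))·2 B_c B_cᵀ B_t equals the zero matrix, so the training update from the true context is ineffective whenever the target and context density matrices have zero trace inner product. -/

import Mathlib

/-- If `B_t` and `B_c` are `n × m` real matrices whose density matrices
`A_t = B_t B_tᵀ` and `A_c = B_c B_cᵀ` have zero trace inner product, then
`B_c B_cᵀ B_t` is the zero matrix, and consequently the Word2DM target-context
gradient term `(1 − σ(0)) · 2 B_c B_cᵀ B_t` is the zero matrix, where `σ` is the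
logistic sigmoid. -/
theorem word2dm_ineffective_update (n m : ℕ)
    (Bt Bc : Matrix (Fin n) (Fin m) ℝ)
    (σ : ℝ → ℝ) (hσ : ∀ x, σ x = 1 / (1 + Real.exp (-x)))
    (h : Matrix.trace (Bt * Bt.transpose * (Bc * Bc.transpose)) = 0) :
    Bc * Bc.transpose * Bt = 0 ∧
      (1 - σ 0) • ((2 : ℝ) • (Bc * Bc.transpose * Bt)) = 0 := by
  have key : Bc.transpose * Bt = 0 := by
    rw [← Matrix.trace_conjTranspose_mul_self_eq_zero_iff, Matrix.conjTranspose_eq_transpose_of_trivial,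
      Matrix.transpose_mul, Matrix.transpose_transpose, ← h, Matrix.mul_assoc Bt,
      Matrix.trace_mul_comm Bt]
    simp only [Matrix.mul_assoc]
  have hzero : Bc * Bc.transpose * Bt = 0 := by
    rw [Matrix.mul_assoc, key, Matrix.mul_zero]
  exact ⟨hzero, by rw [hzero, smul_zero, smul_zero]⟩
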